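/- Let G be a connected solvable linear algebraic group over a field F of characteristic 0, with unipotent radical U and maximal torus T. If the image of the conjugation homomorphism G/DG → Aut(DG/D²G) is a unipotent group, then G is the direct product of U with T. -/

import Mathlib

open Matrix

/-- A subgroup of `GL n F` is algebraic if it is the zero locus, inside
`GL n F`, of a set of polynomials in the matrix entries. -/
def IsAlgebraicSubgroup (F : Type) [Field F] (n : ℕ)
    (G : Subgroup (GL (Fin n) F)) : Prop :=
  ∃ S : Set (MvPolynomial (Fin n × Fin n) F),
    ∀ g : GL (Fin n) F, g ∈ G ↔ ∀ p ∈ S,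
      MvPolynomial.eval (fun ij => (g : Matrix (Fin n) (Fin n) F) ij.1 ij.2) p = 0

/-- An element of `GL n F` is unipotent if `g - 1` is nilpotent. -/
def IsUnipotentElt (F : Type) [Field F] (n : ℕ) (g : GL (Fin n) F) : Prop :=
  IsNilpotent ((g : Matrix (Fin n) (Fin n) F) - 1)

/-- An element of `GL n F` is semisimple if the corresponding endomorphism of
`Fⁿ` is a semisimple linear map. -/
def IsSemisimpleElt (F : Type) [Field F] (n : ℕ) (g : GL (Fin n) F) : Prop :=
  Module.End.IsSemisimple (Matrix.toLin' (g : Matrix (Fin n) (Fin n) F))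

/-- An algebraic subgroup is connected if it has no proper algebraic subgroup
of finite index. -/
def IsConnectedAlgSubgroup (F : Type) [Field F] (n : ℕ)
    (G : Subgroup (GL (Fin n) F)) : Prop :=
  IsAlgebraicSubgroup F n G ∧
  ∀ H : Subgroup (GL (Fin n) F), IsAlgebraicSubgroup F n H → H ≤ G →
    (H.subgroupOf G).FiniteIndex → H = G

section Kolchin

variable {F V Γ : Type*} [Field F] [AddCommGroup V] [Module F V] [Group Γ]

/-- Commuting operators modulo `S`: if a subgroup `H` acts on `P ⊋ S` through unipotent operators
and its commutators act trivially on `P / S`, then `H` fixes a nonzero vector of `P / S`. -/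
theorem exists_fixed_mod_of_commutator_fixed [FiniteDimensional F V] (ρ : Γ →* Module.End F V)
    (hρ : ∀ g, IsNilpotent (ρ g - 1)) (H : Subgroup Γ) {S P : Submodule F V} (hSP : S < P)
    (hS : ∀ g ∈ H, ∀ v ∈ S, ρ g v ∈ S) (hP : ∀ g ∈ H, ∀ v ∈ P, ρ g v ∈ P)
    (hc : ∀ c ∈ ⁅H, H⁆, ∀ v ∈ P, ρ c v - v ∈ S) :
    ∃ v ∈ P, v ∉ S ∧ ∀ g ∈ H, ρ g v - v ∈ S := by
  obtain ⟨M, ⟨⟨hSM, hMP, hM⟩, hmin⟩⟩ := exists_minimal_of_wellFoundedLT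
    (fun M : Submodule F V => S < M ∧ M ≤ P ∧ ∀ g ∈ H, ∀ v ∈ M, ρ g v ∈ M) ⟨P, hSP, le_rfl, hP⟩
  obtain ⟨v, hvM, hvS⟩ := SetLike.exists_of_lt hSM
  refine ⟨v, hMP hvM, hvS, fun g hg => ?_⟩
  let K : Submodule F V := M ⊓ S.comap (ρ g - 1)
  have hKM : K ≤ M := inf_le_left
  suffices M ≤ K from (this hvM).2
  refine hmin ⟨lt_of_le_of_ne ?_ ?_, hKM.trans hMP, ?_⟩ hKM
  · exact fun s hs => ⟨hSM.le hs, S.sub_mem (hS g hg s hs) hs⟩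
  · intro hSK
    have hstep : ∀ w ∈ M, (ρ g - 1) w ∈ S → w ∈ S := fun w hw h => hSK ▸ ⟨hw, h⟩
    have hpow : ∀ j : ℕ, ∀ w ∈ M, ((ρ g - 1) ^ j) w ∈ S → w ∈ S := by
      intro j
      induction j with
      | zero => intro w _ h; simpa using h
      | succ j ih =>
        intro w hw h
        refine hstep w hw (ih _ (M.sub_mem (hM g hg w hw) hw) ?_)
        rwa [pow_succ] at h
    obtain ⟨j, hj⟩ := hρ g
    exact hvS (hpow j v hvM (by rw [hj]; exact S.zero_mem))
  · rintro h hh w ⟨hwM, hwS⟩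
    refine ⟨hM h hh w hwM, ?_⟩
    have hcomm : g⁻¹ * h⁻¹ * g * h ∈ ⁅H, H⁆ := by
      simpa [commutatorElement_def] using
        Subgroup.commutator_mem_commutator (H.inv_mem hg) (H.inv_mem hh)
    have hw : ρ g w - w ∈ S := hwS
    have h1 : ρ h (ρ g w - w) ∈ S := hS h hh _ hw
    have h2 : ρ (h * g) (ρ (g⁻¹ * h⁻¹ * g * h) w - w) ∈ S :=
      hS _ (H.mul_mem hh hg) _ (hc _ hcomm w (hMP hwM))
    have h3 : ρ (h * g) (ρ (g⁻¹ * h⁻¹ * g * h) w) = ρ g (ρ h w) := by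
      rw [← Module.End.mul_apply, ← map_mul, ← Module.End.mul_apply, ← map_mul]
      congr 2
      group
    have h4 := S.add_mem h1 h2
    rw [map_sub, map_sub, h3, map_mul, Module.End.mul_apply] at h4
    change ρ g (ρ h w) - ρ h w ∈ S
    convert h4 using 1
    abel

/-- A solvable group of unipotent operators fixes a nonzero vector of `V / S`. -/
theorem exists_fixed_mod_of_isSolvable [FiniteDimensional F V] [Group.IsSolvable Γ]
    (ρ : Γ →* Module.End F V)
    (hρ : ∀ g, IsNilpotent (ρ g - 1)) {S : Submodule F V} (hSV : S ≠ ⊤)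
    (hS : ∀ g, ∀ v ∈ S, ρ g v ∈ S) : ∃ v ∉ S, ∀ g, ρ g v - v ∈ S := by
  obtain ⟨n, hn⟩ := Group.IsSolvable.solvable (G := Γ)
  have key : ∀ k ≤ n, ∃ v ∉ S, ∀ g ∈ derivedSeries Γ k, ρ g v - v ∈ S := by
    intro k hk
    induction hk using Nat.decreasingInduction with
    | self =>
      obtain ⟨v, -, hv⟩ := SetLike.exists_of_lt (lt_top_iff_ne_top.mpr hSV)
      refine ⟨v, hv, fun g hg => ?_⟩
      rw [hn, Subgroup.mem_bot] at hg
      simp [hg]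
    | of_succ k _ ih =>
      obtain ⟨v, hv, hfix⟩ := ih
      let P : Submodule F V := ⨅ c ∈ derivedSeries Γ (k + 1), S.comap (ρ c - 1)
      have memP : ∀ w, w ∈ P ↔ ∀ c ∈ derivedSeries Γ (k + 1), ρ c w - w ∈ S := by
        intro w; simp [P]
      have hSP : S < P := lt_of_le_of_ne
        (fun s hs => (memP s).mpr fun c _ => S.sub_mem (hS c s hs) hs)
        (fun h => hv (h ▸ (memP v).mpr hfix))
      have hP : ∀ g, ∀ w ∈ P, ρ g w ∈ P := fun g w hw => (memP _).mpr fun c hc => by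
        have hc' : g⁻¹ * c * g ∈ derivedSeries Γ (k + 1) := by
          simpa using (derivedSeries_normal Γ (k + 1)).conj_mem c hc g⁻¹
        have h1 := hS g _ ((memP w).mp hw _ hc')
        have h2 : ρ g (ρ (g⁻¹ * c * g) w) = ρ c (ρ g w) := by
          rw [← Module.End.mul_apply, ← map_mul, ← Module.End.mul_apply, ← map_mul]
          congr 2
          group
        rwa [map_sub, h2] at h1
      obtain ⟨w, -, hw, hwfix⟩ := exists_fixed_mod_of_commutator_fixed ρ hρ (derivedSeries Γ k)
        hSP (fun g _ => hS g) (fun g _ => hP g) (fun c hc w hw => (memP w).mp hw c hc)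
      exact ⟨w, hw, hwfix⟩
  obtain ⟨v, hv, h⟩ := key 0 (Nat.zero_le n)
  exact ⟨v, hv, fun g => h g (by simp)⟩

/-- The linear span of the operators `ρ x - 1`. -/
def augmentationSpan (ρ : Γ →* Module.End F V) : Submodule F (Module.End F V) :=
  Submodule.span F (Set.range fun x => ρ x - 1)

theorem sub_one_mem_augmentationSpan (ρ : Γ →* Module.End F V) (x : Γ) :
    ρ x - 1 ∈ augmentationSpan ρ :=
  Submodule.subset_span ⟨x, rfl⟩

/-- **Kolchin's theorem** for solvable groups of unipotent operators. -/
theorem exists_augmentationSpan_pow_eq_bot [FiniteDimensional F V] [Group.IsSolvable Γ]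
    (ρ : Γ →* Module.End F V)
    (hρ : ∀ g, IsNilpotent (ρ g - 1)) : ∃ k, augmentationSpan ρ ^ k = ⊥ := by
  let fixedMod : Submodule F V → Submodule F V := fun S => ⨅ g, S.comap (ρ g - 1)
  have mem_fixedMod : ∀ S v, v ∈ fixedMod S ↔ ∀ g, ρ g v - v ∈ S := by
    intro S v; simp [fixedMod]
  let S : ℕ → Submodule F V := fun k => fixedMod^[k] ⊥
  have hSsucc : ∀ k, S (k + 1) = fixedMod (S k) := fun k => Function.iterate_succ_apply' _ _ _
  have hSle : ∀ k, S k ≤ S (k + 1) := by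
    intro k
    induction k with
    | zero => exact bot_le
    | succ k ih =>
      intro v hv
      rw [hSsucc, mem_fixedMod] at hv ⊢
      exact fun g => ih (hv g)
  have hSinv : ∀ k g, ∀ v ∈ S k, ρ g v ∈ S k := by
    intro k g v hv
    have h := hSle k hv
    rw [hSsucc, mem_fixedMod] at h
    simpa using (S k).add_mem (h g) hv
  obtain ⟨k, hk⟩ := WellFoundedGT.monotone_chain_condition
    (⟨S, monotone_nat_of_le_succ hSle⟩ : ℕ →o Submodule F V)
  have htop : S k = ⊤ := by
    by_contra hne
    obtain ⟨v, hv, hfix⟩ := exists_fixed_mod_of_isSolvable ρ hρ hne (hSinv k)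
    have h : S k = S (k + 1) := hk (k + 1) k.le_succ
    exact hv (h ▸ hSsucc k ▸ (mem_fixedMod _ _).mpr hfix)
  have hI : ∀ j, ∀ a ∈ augmentationSpan ρ, ∀ v ∈ S (j + 1), a v ∈ S j := by
    intro j a ha v hv
    rw [hSsucc, mem_fixedMod] at hv
    induction ha using Submodule.span_induction with
    | mem a h => obtain ⟨g, rfl⟩ := h; exact hv g
    | zero => exact (S j).zero_mem
    | add a b _ _ ha hb => exact (S j).add_mem ha hb
    | smul c a _ ha => exact (S j).smul_mem c ha
  have hpow : ∀ j, ∀ a ∈ augmentationSpan ρ ^ j, ∀ v ∈ S j, a v = 0 := by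
    intro j
    induction j with
    | zero =>
      intro a _ v hv
      rw [(Submodule.mem_bot F).mp hv, map_zero]
    | succ j ih =>
      intro a ha v hv
      rw [pow_succ] at ha
      induction ha using Submodule.mul_induction_on' with
      | mem_mul_mem b hb c hc => exact ih b hb _ (hI j c hc v hv)
      | add a _ b _ ha hb => rw [LinearMap.add_apply, ha, hb, add_zero]
  refine ⟨k, (Submodule.eq_bot_iff _).mpr fun a ha => ?_⟩
  ext v
  exact hpow k a ha v (htop ▸ Submodule.mem_top)

end Kolchin

section Semisimple

variable {F V : Type*} [Field F] [AddCommGroup V] [Module F V]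

theorem Module.End.IsSemisimple.apply_eq_zero_of_pow_apply_eq_zero {f : Module.End F V}
    (hf : f.IsSemisimple) {k : ℕ} {v : V} (h : (f ^ k) v = 0) : f v = 0 := by
  have hmem : v ∈ f.maxGenEigenspace 0 := by
    rw [Module.End.mem_maxGenEigenspace]
    exact ⟨k, by simpa using h⟩
  rw [hf.isFinitelySemisimple.maxGenEigenspace_eq_eigenspace] at hmem
  simpa using Module.End.mem_eigenspace_iff.mp hmem

theorem Module.End.mem_invtSubmodule_of_mul_eq_one [FiniteDimensional F V]
    {f g : Module.End F V} (h : g * f = 1)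
    {p : Submodule F V} (hp : p ∈ f.invtSubmodule) : p ∈ g.invtSubmodule := by
  have hinj : Function.Injective f :=
    Function.LeftInverse.injective (g := g) fun v => LinearMap.congr_fun h v
  have hmap : p.map f = p := Submodule.eq_of_le_of_finrank_eq
    ((Module.End.mem_invtSubmodule_iff_map_le f).mp hp)
    (LinearEquiv.finrank_eq (Submodule.equivMapOfInjective f hinj p)).symm
  intro v hv
  rw [← hmap] at hv
  obtain ⟨w, hw, rfl⟩ := hv
  have : g (f w) = w := LinearMap.congr_fun h w
  rwa [Submodule.mem_comap, this]

theorem Module.End.IsSemisimple.of_mul_eq_one [FiniteDimensional F V]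
    {f g : Module.End F V} (hf : f.IsSemisimple)
    (h : f * g = 1) : g.IsSemisimple := by
  rw [Module.End.isSemisimple_iff] at hf ⊢
  intro p hp
  obtain ⟨q, hq, hpq⟩ := hf p (Module.End.mem_invtSubmodule_of_mul_eq_one h hp)
  exact ⟨q, Module.End.mem_invtSubmodule_of_mul_eq_one (mul_eq_one_comm.mp h) hq, hpq⟩

/-- The operator `a ↦ t * a * s - a`, where `s` is meant to be the inverse of `t`. -/
def conjSubOne (t s : Module.End F V) : Module.End F (Module.End F V) :=
  LinearMap.mulLeft F t * LinearMap.mulRight F s - 1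

theorem conjSubOne_apply (t s a : Module.End F V) : conjSubOne t s a = t * a * s - a := by
  simp [conjSubOne, mul_assoc]

theorem isSemisimple_conjSubOne [FiniteDimensional F V] [PerfectField F]
    {t s : Module.End F V} (ht : t.IsSemisimple)
    (h : t * s = 1) : (conjSubOne t s).IsSemisimple := by
  have hs : s.IsSemisimple := ht.of_mul_eq_one h
  have hl : Module.End.IsSemisimple (LinearMap.mulLeft F t) := by
    apply Module.End.isSemisimple_of_squarefree_aeval_eq_zero ht.minpoly_squarefree
    have : Polynomial.aeval (Algebra.lmul F (Module.End F V) t) (minpoly F t) = 0 := by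
      rw [Polynomial.aeval_algHom_apply, minpoly.aeval, map_zero]
    simpa using! this
  have hr : Module.End.IsSemisimple (LinearMap.mulRight F s) := by
    apply Module.End.isSemisimple_of_squarefree_aeval_eq_zero hs.minpoly_squarefree
    have hrw : LinearMap.mulRight F s =
        (Algebra.lsmul (A := (Module.End F V)ᵐᵒᵖ) F F (Module.End F V)) (.op s) := by
      ext; simp [Algebra.lsmul]
    rw [hrw, Polynomial.aeval_algHom_apply, Polynomial.aeval_op_apply, minpoly.aeval,
      MulOpposite.op_zero, map_zero]
  exact (hl.mul_of_commute (LinearMap.commute_mulLeft_right t s) hr).sub_of_commute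
    (Commute.one_right _) Module.End.isSemisimple_id

theorem conjSubOne_mul {t s : Module.End F V} (h : s * t = 1) (a b : Module.End F V) :
    conjSubOne t s (a * b) = conjSubOne t s a * (t * b * s) + a * conjSubOne t s b := by
  have h1 : t * a * s * (t * b * s) = t * (a * b) * s := by
    rw [show t * a * s * (t * b * s) = t * a * (s * t) * b * s by noncomm_ring, h]
    noncomm_ring
  simp only [conjSubOne_apply, sub_mul, mul_sub, h1]
  noncomm_ring

theorem conjSubOne_mem_sq {t s : Module.End F V} (h : s * t = 1)
    {I : Submodule F (Module.End F V)} (hI : ∀ a ∈ I, t * a * s ∈ I) {a : Module.End F V}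
    (ha : a ∈ I ^ 2) : conjSubOne t s a ∈ I ^ 2 := by
  have hE : ∀ a ∈ I, conjSubOne t s a ∈ I := fun a ha => by
    rw [conjSubOne_apply]; exact I.sub_mem (hI a ha) ha
  rw [pow_two] at ha ⊢
  induction ha using Submodule.mul_induction_on' with
  | mem_mul_mem a ha b hb =>
    rw [conjSubOne_mul h]
    exact add_mem (Submodule.mul_mem_mul (hE a ha) (hI b hb))
      (Submodule.mul_mem_mul ha (hE b hb))
  | add a _ b _ ha hb => rw [map_add]; exact add_mem ha hb

/-- A semisimple conjugation which acts unipotently on `I / I ^ 2`, for a nilpotent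
space `I` of operators, is trivial on `I`. -/
theorem conjSubOne_eq_zero_of_pow_mem_sq [FiniteDimensional F V] [PerfectField F]
    {t s : Module.End F V}
    (ht : t.IsSemisimple) (h : t * s = 1) {I : Submodule F (Module.End F V)} (hsq : I ^ 2 ≤ I)
    (hI : ∀ a ∈ I, t * a * s ∈ I) {k m : ℕ} (hk : I ^ k = ⊥)
    (hm : ∀ a ∈ I, (conjSubOne t s ^ m) a ∈ I ^ 2) : ∀ a ∈ I, conjSubOne t s a = 0 := by
  have hss := isSemisimple_conjSubOne ht h
  have hst : s * t = 1 := mul_eq_one_comm.mp h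
  obtain ⟨Q, hQ, hcompl⟩ := Module.End.isSemisimple_iff.mp hss (I ^ 2)
    fun _ => conjSubOne_mem_sq hst hI
  have hpowQ : ∀ j, ∀ q ∈ Q, (conjSubOne t s ^ j) q ∈ Q := by
    intro j
    induction j with
    | zero => intro q hq; simpa using hq
    | succ j ih =>
      intro q hq
      rw [pow_succ]
      exact ih _ (hQ hq)
  have hEI : ∀ a ∈ I, conjSubOne t s a ∈ I ^ 2 := by
    intro a ha
    obtain ⟨b, hb, q, hq, rfl⟩ := Submodule.mem_sup.mp
      (hcompl.sup_eq_top ▸ Submodule.mem_top : a ∈ I ^ 2 ⊔ Q)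
    have hqI : q ∈ I := by simpa using I.sub_mem ha (hsq hb)
    have h0 : (conjSubOne t s ^ m) q = 0 :=
      Submodule.disjoint_def.mp hcompl.disjoint _ (hm q hqI) (hpowQ m q hq)
    rw [map_add, hss.apply_eq_zero_of_pow_apply_eq_zero h0, add_zero]
    exact conjSubOne_mem_sq hst hI hb
  have hstep : ∀ j, ∀ a ∈ I ^ (j + 1), conjSubOne t s a ∈ I ^ (j + 2) := by
    intro j
    induction j with
    | zero => simpa using hEI
    | succ j ih =>
      intro a ha
      rw [pow_succ] at ha
      induction ha using Submodule.mul_induction_on' with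
      | mem_mul_mem a ha b hb =>
        rw [conjSubOne_mul hst]
        refine add_mem ?_ ?_
        · rw [pow_succ]
          exact Submodule.mul_mem_mul (ih a ha) (hI b hb)
        · rw [show j + 1 + 2 = (j + 1) + 2 from rfl, pow_add]
          exact Submodule.mul_mem_mul ha (hEI b hb)
      | add a _ b _ ha hb => rw [map_add]; exact add_mem ha hb
  have hiter : ∀ j, ∀ a ∈ I, (conjSubOne t s ^ j) a ∈ I ^ (j + 1) := by
    intro j a ha
    induction j with
    | zero => simpa using ha
    | succ j ih =>
      rw [pow_succ' (conjSubOne t s)]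
      exact hstep j _ ih
  intro a ha
  refine hss.apply_eq_zero_of_pow_apply_eq_zero (k := k) ?_
  have := hiter k a ha
  rw [pow_succ, hk, Submodule.bot_mul] at this
  exact (Submodule.mem_bot F).mp this

end Semisimple

section Commutators

open scoped commutatorElement

variable {F V Γ : Type*} [Field F] [AddCommGroup V] [Module F V] [Group Γ]

theorem augmentationSpan_sq_le (ρ : Γ →* Module.End F V) :
    augmentationSpan ρ ^ 2 ≤ augmentationSpan ρ := by
  rw [pow_two, augmentationSpan, Submodule.span_mul_span, Submodule.span_le]
  rintro _ ⟨_, ⟨x, rfl⟩, _, ⟨y, rfl⟩, rfl⟩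
  have : (ρ x - 1) * (ρ y - 1) = (ρ (x * y) - 1) - (ρ x - 1) - (ρ y - 1) := by
    rw [map_mul]; noncomm_ring
  change (ρ x - 1) * (ρ y - 1) ∈ augmentationSpan ρ
  rw [this]
  exact sub_mem (sub_mem (sub_one_mem_augmentationSpan ρ _) (sub_one_mem_augmentationSpan ρ _))
    (sub_one_mem_augmentationSpan ρ _)

theorem mul_mem_augmentationSpan_sq (ρ : Γ →* Module.End F V) {a : Module.End F V}
    (ha : a ∈ augmentationSpan ρ ^ 2) (x : Γ) : a * ρ x ∈ augmentationSpan ρ ^ 2 := by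
  have h : a * (ρ x - 1) ∈ augmentationSpan ρ ^ 2 := by
    rw [pow_two]
    exact Submodule.mul_mem_mul (augmentationSpan_sq_le ρ ha) (sub_one_mem_augmentationSpan ρ x)
  have : a * ρ x = a * (ρ x - 1) + a := by noncomm_ring
  rw [this]
  exact add_mem h ha

theorem sub_one_mem_augmentationSpan_sq (ρ : Γ →* Module.End F V) {c : Γ}
    (hc : c ∈ commutator Γ) : ρ c - 1 ∈ augmentationSpan ρ ^ 2 := by
  let K : Subgroup Γ :=
    { carrier := {c | ρ c - 1 ∈ augmentationSpan ρ ^ 2}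
      one_mem' := by simp
      mul_mem' := fun {x y} hx hy => by
        have : ρ (x * y) - 1 = (ρ x - 1) * ρ y + (ρ y - 1) := by rw [map_mul]; noncomm_ring
        rw [Set.mem_ofPred_eq, this]
        exact add_mem (mul_mem_augmentationSpan_sq ρ hx y) hy
      inv_mem' := fun {x} hx => by
        have : ρ x⁻¹ - 1 = -((ρ x - 1) * ρ x⁻¹) := by
          rw [sub_mul, ← map_mul, mul_inv_cancel, map_one]; noncomm_ring
        rw [Set.mem_ofPred_eq, this]
        exact neg_mem (mul_mem_augmentationSpan_sq ρ hx _) }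
  suffices commutator Γ ≤ K from this hc
  rw [commutator_def, Subgroup.commutator_le]
  intro x _ y _
  have hxy : (ρ x - 1) * (ρ y - 1) - (ρ y - 1) * (ρ x - 1) ∈ augmentationSpan ρ ^ 2 := by
    rw [pow_two]
    exact sub_mem
      (Submodule.mul_mem_mul (sub_one_mem_augmentationSpan ρ x) (sub_one_mem_augmentationSpan ρ y))
      (Submodule.mul_mem_mul (sub_one_mem_augmentationSpan ρ y) (sub_one_mem_augmentationSpan ρ x))
  have : ρ ⁅x, y⁆ - 1 =
      ((ρ x - 1) * (ρ y - 1) - (ρ y - 1) * (ρ x - 1)) * ρ (y * x)⁻¹ := by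
    have h1 : (ρ x - 1) * (ρ y - 1) - (ρ y - 1) * (ρ x - 1) = ρ (x * y) - ρ (y * x) := by
      rw [map_mul, map_mul]; noncomm_ring
    rw [h1, sub_mul, ← map_mul, ← map_mul, mul_inv_cancel, map_one, commutatorElement_def]
    simp [mul_assoc]
  change ρ ⁅x, y⁆ - 1 ∈ augmentationSpan ρ ^ 2
  rw [this]
  exact mul_mem_augmentationSpan_sq ρ hxy _

variable [FiniteDimensional F V] [PerfectField F]

/-- Let `t` normalize a solvable group `N` of unipotent operators.  If `t` is semisimple and acts
unipotently on the abelianization of `N`, then `t` centralizes `N`. -/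
theorem commute_of_iterate_commutator_mem (ρ : Γ →* Module.End F V) (N : Subgroup Γ)
    [Group.IsSolvable N] (hN : ∀ x ∈ N, IsNilpotent (ρ x - 1)) {t : Γ} (ht : (ρ t).IsSemisimple)
    (hconj : ∀ x ∈ N, t * x * t⁻¹ ∈ N) {m : ℕ}
    (hm : ∀ x ∈ N, (fun y => t * y * t⁻¹ * y⁻¹)^[m] x ∈ ⁅N, N⁆) {x : Γ} (hx : x ∈ N) :
    Commute (ρ t) (ρ x) := by
  let σ : N →* Module.End F V := ρ.comp N.subtype
  have memI : ∀ y ∈ N, ρ y - 1 ∈ augmentationSpan σ := fun y hy =>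
    sub_one_mem_augmentationSpan σ ⟨y, hy⟩
  have hts : ρ t * ρ t⁻¹ = 1 := by rw [← map_mul, mul_inv_cancel, map_one]
  have hst : ρ t⁻¹ * ρ t = 1 := by rw [← map_mul, inv_mul_cancel, map_one]
  have hI : ∀ a ∈ augmentationSpan σ, ρ t * a * ρ t⁻¹ ∈ augmentationSpan σ := by
    intro a ha
    induction ha using Submodule.span_induction with
    | mem a h =>
      obtain ⟨y, rfl⟩ := h
      have : ρ t * (σ y - 1) * ρ t⁻¹ = ρ (t * y * t⁻¹) - 1 := by
        rw [mul_sub, sub_mul, mul_one, hts, map_mul, map_mul]; rfl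
      rw [this]
      exact memI _ (hconj y y.2)
    | zero => simp
    | add a b _ _ ha hb => rw [mul_add, add_mul]; exact add_mem ha hb
    | smul c a _ ha =>
      rw [mul_smul_comm, smul_mul_assoc]; exact Submodule.smul_mem _ c ha
  have hcm : ∀ y ∈ N, t * y * t⁻¹ * y⁻¹ ∈ N := fun y hy => N.mul_mem (hconj y hy) (N.inv_mem hy)
  have hiter : ∀ j : ℕ, ∀ y ∈ N, (fun y => t * y * t⁻¹ * y⁻¹)^[j] y ∈ N ∧
      (conjSubOne (ρ t) (ρ t⁻¹) ^ j) (ρ y - 1) -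
        (ρ ((fun y => t * y * t⁻¹ * y⁻¹)^[j] y) - 1) ∈ augmentationSpan σ ^ 2 := by
    intro j y hy
    induction j with
    | zero => simpa using hy
    | succ j ih =>
      rw [Function.iterate_succ_apply', pow_succ' (conjSubOne _ _)]
      obtain ⟨hz, hd⟩ := ih
      generalize (fun y => t * y * t⁻¹ * y⁻¹)^[j] y = z at hz hd ⊢
      refine ⟨hcm z hz, ?_⟩
      have h1 := conjSubOne_mem_sq hst hI hd
      rw [map_sub] at h1
      have h2 : conjSubOne (ρ t) (ρ t⁻¹) (ρ z - 1) =
          (ρ (t * z * t⁻¹ * z⁻¹) - 1) + (ρ (t * z * t⁻¹ * z⁻¹) - 1) * (ρ z - 1) := by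
        have h3 : ρ (t * z * t⁻¹ * z⁻¹) * ρ z = ρ t * ρ z * ρ t⁻¹ := by
          rw [← map_mul, ← map_mul, ← map_mul]
          congr 1
          group
        rw [conjSubOne_apply, sub_mul, mul_sub, mul_sub, sub_mul, h3, mul_one, mul_one, hts]
        noncomm_ring
      have h4 : (ρ (t * z * t⁻¹ * z⁻¹) - 1) * (ρ z - 1) ∈ augmentationSpan σ ^ 2 := by
        rw [pow_two]
        exact Submodule.mul_mem_mul (memI _ (hcm z hz)) (memI z hz)
      have h5 := add_mem h1 h4
      rw [h2] at h5
      rw [Module.End.mul_apply]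
      convert h5 using 1
      abel
  have hmI : ∀ a ∈ augmentationSpan σ,
      (conjSubOne (ρ t) (ρ t⁻¹) ^ m) a ∈ augmentationSpan σ ^ 2 := by
    intro a ha
    induction ha using Submodule.span_induction with
    | mem a h =>
      obtain ⟨y, rfl⟩ := h
      have h1 := (hiter m y y.2).2
      have h2 := hm y y.2
      rw [← Subgroup.map_subtype_commutator] at h2
      obtain ⟨c, hc, hcy⟩ := h2
      rw [← hcy] at h1
      simpa [σ] using add_mem h1 (sub_one_mem_augmentationSpan_sq σ hc)
    | zero => simp
    | add a b _ _ ha hb => rw [map_add]; exact add_mem ha hb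
    | smul c a _ ha => rw [map_smul]; exact Submodule.smul_mem _ c ha
  obtain ⟨k, hk⟩ := exists_augmentationSpan_pow_eq_bot σ fun y => hN y y.2
  have h0 := conjSubOne_eq_zero_of_pow_mem_sq ht hts (augmentationSpan_sq_le σ) hI hk hmI
    _ (memI x hx)
  rw [conjSubOne_apply, mul_sub, sub_mul, mul_one, hts, sub_sub_sub_cancel_right, sub_eq_zero] at h0
  change ρ t * ρ x = ρ x * ρ t
  nth_rewrite 2 [← h0]
  rw [mul_assoc, hst, mul_one]

/-- If `t` is semisimple and commutes with a unipotent commutator `[t, u]`, then `t` commutes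
with `u`. -/
theorem commute_of_commute_commutator (ρ : Γ →* Module.End F V) {t u : Γ}
    (ht : (ρ t).IsSemisimple) (hz : IsNilpotent (ρ (t * u * t⁻¹ * u⁻¹) - 1))
    (hc : Commute (ρ t) (ρ (t * u * t⁻¹ * u⁻¹))) : Commute (ρ t) (ρ u) := by
  have hts : ρ t * ρ t⁻¹ = 1 := by rw [← map_mul, mul_inv_cancel, map_one]
  have hst : ρ t⁻¹ * ρ t = 1 := by rw [← map_mul, inv_mul_cancel, map_one]
  have hzu : ρ (t * u * t⁻¹ * u⁻¹) * ρ u = ρ t * ρ u * ρ t⁻¹ := by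
    rw [← map_mul, ← map_mul, ← map_mul]
    congr 1
    group
  generalize ρ (t * u * t⁻¹ * u⁻¹) = z at hz hc hzu
  have hpow : ∀ j : ℕ, (conjSubOne (ρ t) (ρ t⁻¹) ^ j) (ρ u) = (z - 1) ^ j * ρ u := by
    intro j
    induction j with
    | zero => simp
    | succ j ih =>
      have hcj : Commute (ρ t) ((z - 1) ^ j) := (hc.sub_right (Commute.one_right _)).pow_right j
      rw [pow_succ', Module.End.mul_apply, ih, conjSubOne_apply, ← mul_assoc, hcj.eq, mul_assoc,
        mul_assoc, ← mul_assoc (ρ t), ← hzu, pow_succ]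
      noncomm_ring
  obtain ⟨j, hj⟩ := hz
  have h0 := (isSemisimple_conjSubOne ht hts).apply_eq_zero_of_pow_apply_eq_zero (k := j)
    (v := ρ u) (by rw [hpow, hj, zero_mul])
  rw [conjSubOne_apply, sub_eq_zero] at h0
  change ρ t * ρ u = ρ u * ρ t
  nth_rewrite 2 [← h0]
  rw [mul_assoc, hst, mul_one]

/-- If `G = T U` with `T` commutative and `U` normalized by `G`, then `U` contains the
derived subgroup of `G`. -/
theorem commutator_le_of_eq_mul {G U T : Subgroup Γ} (hTG : T ≤ G)
    (hUnormal : ∀ g ∈ G, ∀ u ∈ U, g * u * g⁻¹ ∈ U) (hTcomm : ∀ t ∈ T, ∀ t' ∈ T, Commute t t')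
    (hprod : ∀ g ∈ G, ∃ t ∈ T, ∃ u ∈ U, g = t * u) : ⁅G, G⁆ ≤ U := by
  rw [Subgroup.commutator_le]
  intro g hg h hh
  obtain ⟨t, ht, u, hu, rfl⟩ := hprod g hg
  obtain ⟨s, hs, v, hv, rfl⟩ := hprod h hh
  have h1 := hUnormal t (hTG ht) u hu
  have h2 := hUnormal (t * s) (hTG (T.mul_mem ht hs)) (v * u⁻¹) (U.mul_mem hv (U.inv_mem hu))
  have h3 := hUnormal s (hTG hs) v⁻¹ (U.inv_mem hv)
  have hst : t * s * t⁻¹ = s := by rw [(hTcomm t ht s hs).eq, mul_inv_cancel_right]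
  have : ⁅t * u, s * v⁆ =
      (t * u * t⁻¹) * (t * s * (v * u⁻¹) * (t * s)⁻¹) * (s * v⁻¹ * s⁻¹) := by
    nth_rewrite 4 [← hst]
    rw [commutatorElement_def]
    group
  rw [this]
  exact U.mul_mem (U.mul_mem h1 h2) h3

end Commutators

/-- Let `G` be a connected solvable linear algebraic group over a field `F` of
characteristic `0`, with unipotent radical `U` and maximal torus `T`.  If the
image of the conjugation action of `G/DG` on `DG/D²G` is unipotent (i.e. the
conjugation action of every `g ∈ G` on the abelian quotient `DG/D²G` is
unipotent), then `T` and `U` commute elementwise, so `G` is the direct product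
of `U` with `T`. -/
theorem statement7 (F : Type) [Field F] [CharZero F] (n : ℕ)
    (G U T : Subgroup (GL (Fin n) F))
    (hGconn : IsConnectedAlgSubgroup F n G) (hGsolv : IsSolvable ↥G)
    (hUalg : IsAlgebraicSubgroup F n U) (hUG : U ≤ G)
    (hUnormal : ∀ g ∈ G, ∀ u ∈ U, g * u * g⁻¹ ∈ U)
    (hUunip : ∀ u ∈ U, IsUnipotentElt F n u)
    (hUall : ∀ g ∈ G, IsUnipotentElt F n g → g ∈ U)
    (hTalg : IsAlgebraicSubgroup F n T) (hTG : T ≤ G)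
    (hTcomm : ∀ t ∈ T, ∀ t' ∈ T, Commute t t')
    (hTss : ∀ t ∈ T, IsSemisimpleElt F n t)
    (hTconn : IsConnectedAlgSubgroup F n T)
    (hTmax : ∀ T' : Subgroup (GL (Fin n) F), IsAlgebraicSubgroup F n T' →
      T' ≤ G → (∀ t ∈ T', ∀ t' ∈ T', Commute t t') →
      (∀ t ∈ T', IsSemisimpleElt F n t) → T ≤ T' → T' = T)
    (hprod : ∀ g ∈ G, ∃ t ∈ T, ∃ u ∈ U, g = t * u)
    (hint : T ⊓ U = ⊥)
    (hunipaction : ∃ m : ℕ, ∀ g ∈ G, ∀ x ∈ ⁅G, G⁆,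
      (fun y => g * y * g⁻¹ * y⁻¹)^[m] x ∈ ⁅(⁅G, G⁆ : Subgroup (GL (Fin n) F)), ⁅G, G⁆⁆) :
    ∀ t ∈ T, ∀ u ∈ U, Commute t u := by
  obtain ⟨m, hm⟩ := hunipaction
  have hNU : ⁅G, G⁆ ≤ U := commutator_le_of_eq_mul hTG hUnormal hTcomm hprod
  have hNG : ⁅G, G⁆ ≤ G := hNU.trans hUG
  let φ : Matrix (Fin n) (Fin n) F ≃ₐ[F] Module.End F (Fin n → F) := Matrix.toLinAlgEquiv'
  let ρ : GL (Fin n) F →* Module.End F (Fin n → F) :=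
    (φ : Matrix (Fin n) (Fin n) F →* Module.End F (Fin n → F)).comp (Units.coeHom _)
  have hρnil : ∀ x ∈ U, IsNilpotent (ρ x - 1) := fun x hx => by
    have h := (hUunip x hx).map φ
    rwa [map_sub, map_one] at h
  have : Group.IsSolvable G := hGsolv
  have : Group.IsSolvable (⁅G, G⁆ : Subgroup (GL (Fin n) F)) :=
    Group.isSolvable_of_isSolvable_injective (Subgroup.inclusion_injective hNG)
  intro t ht u hu
  have hts : (ρ t).IsSemisimple := hTss t ht
  have hz : t * u * t⁻¹ * u⁻¹ ∈ ⁅G, G⁆ :=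
    Subgroup.commutator_mem_commutator (hTG ht) (hUG hu)
  have hconj : ∀ x ∈ ⁅G, G⁆, t * x * t⁻¹ ∈ ⁅G, G⁆ := fun x hx => by
    have h := Subgroup.mul_mem _ (Subgroup.commutator_mem_commutator (hTG ht) (hNG hx)) hx
    rwa [commutatorElement_def, inv_mul_cancel_right] at h
  have hcomm := commute_of_commute_commutator ρ hts (hρnil _ (hNU hz))
    (commute_of_iterate_commutator_mem ρ ⁅G, G⁆ (fun x hx => hρnil x (hNU hx)) hts hconj
      (hm t (hTG ht)) hz)
  have hinj : Function.Injective ρ := φ.injective.comp Units.val_injective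
  exact hinj (by rw [map_mul, map_mul]; exact hcomm)
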